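/- The universal associative enveloping algebra U(A^T) = ℚ⟨a,b,c,d⟩/I^T is infinite dimensional over ℚ, with basis given by the cosets of the monomials a^m for all m ≥ 0 (where a⁰ = 1), together with b, c, ab, ca, cb, and a^n·d for 0 ≤ n ≤ 2. -/

import Mathlib

/-- The free unital associative ℚ-algebra ℚ⟨a,b,c,d⟩ on four generators
`a = e₁₁, b = e₁₂, c = e₂₁, d = e₂₂`. -/
abbrev FreeA : Type := FreeAlgebra ℚ (Fin 4)

/-- The generators `e₁₁ = a, e₁₂ = b, e₂₁ = c, e₂₂ = d` of ℚ⟨a,b,c,d⟩,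
indexed by pairs `(i,j)` with `i,j ∈ {1,2}`. -/
def gen (i j : Fin 2) : FreeA :=
  FreeAlgebra.ι ℚ (⟨2 * i.val + j.val, by omega⟩ : Fin 4)

/-- The 2×2 matrix units `E_ij` over ℚ. -/
noncomputable def matUnit (i j : Fin 2) : Matrix (Fin 2) (Fin 2) ℚ :=
  Matrix.single i j 1

/-- The ℚ-linear map `η : M₂(ℚ) → ℚ⟨a,b,c,d⟩` with `η(E_ij) = e_ij`. -/
noncomputable def eta (x : Matrix (Fin 2) (Fin 2) ℚ) : FreeA :=
  ∑ i : Fin 2, ∑ j : Fin 2, x i j • gen i j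

/-- The 64 generators `e_ij e_kl e_st − e_kl e_st e_ij − η(⟨E_ij, E_kl, E_st⟩)`
of the ideal `I^T`, coming from the special translator `⟨x,y,z⟩ = xyz − yzx`
on the associative triple system M₂(ℚ). -/
noncomputable def genSetT : Set FreeA :=
  { g | ∃ i j k l s t : Fin 2,
      g = gen i j * gen k l * gen s t - gen k l * gen s t * gen i j
          - eta (matUnit i j * matUnit k l * matUnit s t
                 - matUnit k l * matUnit s t * matUnit i j) }

/-- The two-sided ideal `I^T` of ℚ⟨a,b,c,d⟩. -/
noncomputable def idealT : TwoSidedIdeal FreeA := TwoSidedIdeal.span genSetT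

/-- The relation on ℚ⟨a,b,c,d⟩ identifying each generator of `I^T` with 0;
quotienting by it yields ℚ⟨a,b,c,d⟩/I^T. -/
noncomputable def relT : FreeA → FreeA → Prop := fun x y => x ∈ genSetT ∧ y = 0

/-- The universal associative enveloping algebra `U(A^T) = ℚ⟨a,b,c,d⟩/I^T`. -/
noncomputable abbrev UT : Type := RingQuot relT

/-- The quotient map ℚ⟨a,b,c,d⟩ → U(A^T). -/
noncomputable def mkT : FreeA →ₐ[ℚ] UT := RingQuot.mkAlgHom ℚ relT

/-- The cosets of the monomials `a^m` (m ≥ 0), `b, c, ab, ca, cb`, and `a^n·d`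
(0 ≤ n ≤ 2) in `U(A^T)`. -/
noncomputable def basisT : ℕ ⊕ Fin 5 ⊕ Fin 3 → UT :=
  let a := gen 0 0; let b := gen 0 1; let c := gen 1 0; let d := gen 1 1
  fun i => match i with
  | Sum.inl m => mkT (a ^ m)
  | Sum.inr (Sum.inl j) => ![mkT b, mkT c, mkT (a * b), mkT (c * a), mkT (c * b)] j
  | Sum.inr (Sum.inr n) => mkT (a ^ (n : ℕ) * d)


section Consequences

variable {R : Type*} [Ring R]

/-- The defining relations in coordinate form. -/
def Rels (G : Fin 2 → Fin 2 → R) : Prop :=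
  ∀ i j k l s t : Fin 2, G i j * G k l * G s t - G k l * G s t * G i j =
    (if j = k ∧ l = s then G i t else 0) - (if l = s ∧ t = i then G k j else 0)

/-- If `y z` commutes with `w` and `x`, the derivation rule gives a quadratic relation. -/
lemma quad_rel (y z w x u v : R) (h1 : w * (y * z) = y * z * w) (h2 : x * (y * z) = y * z * x)
    (h3 : y * w * x - w * x * y = u) (h4 : z * w * x - w * x * z = v) : u * z + y * v = 0 := by
  have h : y * z * (w * x) = w * x * (y * z) := by
    calc y * z * (w * x) = (y * z * w) * x := by noncomm_ring
      _ = w * (y * z * x) := by rw [← h1]; noncomm_ring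
      _ = w * x * (y * z) := by rw [← h2]; noncomm_ring
  rw [← h3, ← h4]
  calc _ = y * z * (w * x) - w * x * (y * z) := by noncomm_ring
    _ = 0 := by rw [h, sub_self]

variable {G : Fin 2 → Fin 2 → R} (H : Rels G)

lemma Rels.r (H : Rels G) (i j k l s t : Fin 2) :
    G i j * G k l * G s t - G k l * G s t * G i j =
    (if j = k ∧ l = s then G i t else 0) - (if l = s ∧ t = i then G k j else 0) :=
  H i j k l s t

lemma Rels.zero_prod (H : Rels G) (i j l t : Fin 2) {k s : Fin 2} (h : l ≠ s) :
    G i j * (G k l * G s t) = G k l * G s t * G i j := by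
  have := H i j k l s t
  simp only [h, and_false, false_and, if_false, sub_self] at this
  rw [← mul_assoc]; exact sub_eq_zero.mp this

lemma Rels.ba (H : Rels G) : G 0 1 * G 0 0 = 0 := by
  have := quad_rel (G 0 1) (G 0 0) (G 0 0) (G 0 0) _ _ (H.zero_prod _ _ _ _ (by decide))
    (H.zero_prod _ _ _ _ (by decide)) (H.r _ _ _ _ _ _) (H.r _ _ _ _ _ _)
  simpa using this

lemma Rels.bb (H : Rels G) : G 0 1 * G 0 1 = 0 := by
  have := quad_rel (G 0 1) (G 0 0) (G 0 0) (G 0 1) _ _ (H.zero_prod _ _ _ _ (by decide))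
    (H.zero_prod _ _ _ _ (by decide)) (H.r _ _ _ _ _ _) (H.r _ _ _ _ _ _)
  simpa using this

lemma Rels.ac (H : Rels G) : G 0 0 * G 1 0 = 0 := by
  have := quad_rel (G 0 0) (G 1 0) (G 0 0) (G 0 0) _ _ (H.zero_prod _ _ _ _ (by decide))
    (H.zero_prod _ _ _ _ (by decide)) (H.r _ _ _ _ _ _) (H.r _ _ _ _ _ _)
  simpa using this

lemma Rels.cc (H : Rels G) : G 1 0 * G 1 0 = 0 := by
  have := quad_rel (G 0 0) (G 1 0) (G 1 0) (G 0 0) _ _ (H.zero_prod _ _ _ _ (by decide))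
    (H.zero_prod _ _ _ _ (by decide)) (H.r _ _ _ _ _ _) (H.r _ _ _ _ _ _)
  simpa using this

lemma Rels.bc (H : Rels G) : G 0 1 * G 1 0 = G 0 0 * G 0 0 - G 0 0 * G 1 1 := by
  have := quad_rel (G 0 0) (G 1 0) (G 0 0) (G 0 1) _ _ (H.zero_prod _ _ _ _ (by decide))
    (H.zero_prod _ _ _ _ (by decide)) (H.r _ _ _ _ _ _) (H.r _ _ _ _ _ _)
  simp [mul_sub] at this
  rw [← sub_eq_zero, ← this]; abel

lemma Rels.db (H : Rels G) : G 1 1 * G 0 1 = 0 := by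
  have := quad_rel (G 1 1) (G 0 1) (G 0 0) (G 0 0) _ _ (H.zero_prod _ _ _ _ (by decide))
    (H.zero_prod _ _ _ _ (by decide)) (H.r _ _ _ _ _ _) (H.r _ _ _ _ _ _)
  simpa using this

lemma Rels.cd (H : Rels G) : G 1 0 * G 1 1 = 0 := by
  have := quad_rel (G 1 0) (G 1 1) (G 0 0) (G 0 0) _ _ (H.zero_prod _ _ _ _ (by decide))
    (H.zero_prod _ _ _ _ (by decide)) (H.r _ _ _ _ _ _) (H.r _ _ _ _ _ _)
  simpa using this

lemma Rels.dd' (H : Rels G) : G 1 1 * G 1 1 = G 1 0 * G 0 1 + G 1 1 * G 0 0 := by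
  have := quad_rel (G 1 1) (G 0 1) (G 1 0) (G 0 0) _ _ (H.zero_prod _ _ _ _ (by decide))
    (H.zero_prod _ _ _ _ (by decide)) (H.r _ _ _ _ _ _) (H.r _ _ _ _ _ _)
  simp [mul_sub] at this
  rw [← sub_eq_zero, ← neg_eq_zero, ← this]; abel

lemma Rels.dd (H : Rels G) : G 1 1 * G 1 1 = G 1 0 * G 0 1 + G 0 0 * G 1 1 := by
  have := quad_rel (G 1 0) (G 1 1) (G 0 0) (G 0 1) _ _ (H.zero_prod _ _ _ _ (by decide))
    (H.zero_prod _ _ _ _ (by decide)) (H.r _ _ _ _ _ _) (H.r _ _ _ _ _ _)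
  simp [sub_mul] at this
  rw [← sub_eq_zero, ← this]; abel

lemma Rels.da (H : Rels G) : G 1 1 * G 0 0 = G 0 0 * G 1 1 :=
  add_left_cancel (H.dd'.symm.trans H.dd)

lemma Rels.aab (H : Rels G) : G 0 0 * (G 0 0 * G 0 1) = G 0 1 := by
  have := H 0 1 0 0 0 0
  simpa [H.ba, mul_assoc] using this

lemma Rels.caa (H : Rels G) : G 1 0 * (G 0 0 * G 0 0) = G 1 0 := by
  have := H 1 0 0 0 0 0
  simpa [H.ac, mul_assoc] using this

lemma Rels.bd (H : Rels G) : G 0 1 * G 1 1 = G 0 0 * G 0 1 := by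
  -- `a * (b d) = b d a + b` and `a (a b) = b`
  have h1 : G 0 0 * (G 0 1 * G 1 1) = G 0 1 := by
    have := H 0 0 0 1 1 1
    simpa [H.da, H.ba, mul_assoc, ← mul_assoc (G 0 1) (G 0 0)] using this
  have h2 : G 0 0 * (G 0 0 * (G 0 1 * G 1 1)) = G 0 1 * G 1 1 := by
    rw [← mul_assoc (G 0 0) (G 0 1), ← mul_assoc (G 0 0), H.aab]
  rw [← h2, h1]

lemma Rels.dc (H : Rels G) : G 1 1 * G 1 0 = G 1 0 * G 0 0 := by
  have h1 : G 1 1 * G 1 0 * G 0 0 = G 1 0 := by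
    have := H 0 0 1 1 1 0
    have h0 : G 0 0 * G 1 1 * G 1 0 = 0 := by rw [← H.da, mul_assoc, H.ac, mul_zero]
    rw [h0] at this
    simpa using this
  have h2 : G 1 1 * G 1 0 * G 0 0 * G 0 0 = G 1 1 * G 1 0 := by
    rw [mul_assoc, mul_assoc, H.caa]
  rw [← h2, h1]

lemma Rels.cab (H : Rels G) : G 1 0 * (G 0 0 * G 0 1) =
    G 0 0 ^ 3 - G 0 0 ^ 2 * G 1 1 + G 1 1 - G 0 0 := by
  have := H 1 0 0 0 0 1
  simp [mul_assoc, H.bc] at this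
  rw [sub_eq_iff_eq_add] at this
  rw [this]; noncomm_ring

lemma Rels.aaad (H : Rels G) : G 0 0 ^ 3 * G 1 1 = G 0 0 ^ 4 - G 0 0 ^ 2 + G 0 0 * G 1 1 := by
  have h : G 0 0 * (G 0 0 * G 0 1) * G 1 0 = G 0 1 * G 1 0 := by rw [H.aab]
  have h' : G 0 0 * (G 0 0 * G 0 1) * G 1 0 = G 0 0 ^ 4 - G 0 0 ^ 3 * G 1 1 := by
    calc _ = G 0 0 * (G 0 0 * (G 0 1 * G 1 0)) := by noncomm_ring
      _ = _ := by rw [H.bc]; noncomm_ring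
  rw [h', H.bc, sub_eq_iff_eq_add] at h
  rw [h]; noncomm_ring

end Consequences

lemma single3 (i j k l s t : Fin 2) (x y z : ℚ) :
    Matrix.single i j x * Matrix.single k l y * Matrix.single s t z =
    if j = k ∧ l = s then Matrix.single i t (x * y * z) else 0 := by
  by_cases h1 : j = k
  · subst h1
    by_cases h2 : l = s
    · subst h2; simp
    · simp [h2]
  · simp [h1]

lemma eta_sub (x y : Matrix (Fin 2) (Fin 2) ℚ) :
    _root_.eta (x - y) = _root_.eta x - _root_.eta y := by
  simp [_root_.eta, Fin.sum_univ_two, sub_smul]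
  try abel

lemma eta_ite (p : Prop) [Decidable p] (i j : Fin 2) :
    _root_.eta (if p then Matrix.single i j (1 : ℚ) else 0) = if p then gen i j else 0 := by
  split_ifs
  · fin_cases i <;> fin_cases j <;> simp [_root_.eta, Fin.sum_univ_two, Matrix.single]
  · simp [_root_.eta]

lemma eta_translator (i j k l s t : Fin 2) :
    _root_.eta (matUnit i j * matUnit k l * matUnit s t
      - matUnit k l * matUnit s t * matUnit i j) =
    (if j = k ∧ l = s then gen i t else 0) - (if l = s ∧ t = i then gen k j else 0) := by
  simp only [matUnit, single3, eta_sub, mul_one, eta_ite]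

/-- The images of the generators in the quotient. -/
noncomputable def g (i j : Fin 2) : UT := mkT (gen i j)

lemma rels_g : Rels g := by
  intro i j k l s t
  have h : mkT (gen i j * gen k l * gen s t - gen k l * gen s t * gen i j
          - eta (matUnit i j * matUnit k l * matUnit s t
                 - matUnit k l * matUnit s t * matUnit i j)) = mkT 0 :=
    RingQuot.mkAlgHom_rel ℚ ⟨⟨i, j, k, l, s, t, rfl⟩, rfl⟩
  rw [map_zero, map_sub, sub_eq_zero, map_sub, map_mul, map_mul, map_mul, map_mul] at h
  change g i j * g k l * g s t - g k l * g s t * g i j = _ at h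
  rw [h]
  rw [eta_translator, map_sub, apply_ite mkT, apply_ite mkT, map_zero]
  rfl

lemma mkT_gen (i j : Fin 2) : mkT (gen i j) = g i j := rfl

/-- The span of the proposed basis. -/
noncomputable def S : Submodule ℚ UT := Submodule.span ℚ (Set.range basisT)

lemma memA (m : ℕ) : g 0 0 ^ m ∈ S := by
  have : basisT (Sum.inl m) ∈ S := Submodule.subset_span ⟨_, rfl⟩
  simpa [basisT, g] using this

lemma memB : g 0 1 ∈ S := Submodule.subset_span ⟨Sum.inr (Sum.inl 0), rfl⟩
lemma memC : g 1 0 ∈ S := Submodule.subset_span ⟨Sum.inr (Sum.inl 1), rfl⟩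
lemma memAB : g 0 0 * g 0 1 ∈ S :=
  Submodule.subset_span ⟨Sum.inr (Sum.inl 2), by simp [basisT, g]⟩
lemma memCA : g 1 0 * g 0 0 ∈ S :=
  Submodule.subset_span ⟨Sum.inr (Sum.inl 3), by simp [basisT, g]⟩
lemma memCB : g 1 0 * g 0 1 ∈ S :=
  Submodule.subset_span ⟨Sum.inr (Sum.inl 4), by simp [basisT, g]⟩

lemma memAD (m : ℕ) : g 0 0 ^ m * g 1 1 ∈ S := by
  induction m using Nat.strong_induction_on with
  | _ m ih =>
    by_cases hm : m < 3
    · have : basisT (Sum.inr (Sum.inr ⟨m, hm⟩)) ∈ S := Submodule.subset_span ⟨_, rfl⟩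
      simpa [basisT, g] using this
    · obtain ⟨k, rfl⟩ : ∃ k, m = k + 3 := ⟨m - 3, by omega⟩
      have : g 0 0 ^ (k + 3) * g 1 1 =
          g 0 0 ^ (k + 4) - g 0 0 ^ (k + 2) + g 0 0 ^ (k + 1) * g 1 1 := by
        rw [pow_add, mul_assoc, rels_g.aaad, mul_add, mul_sub, ← pow_add, ← pow_add,
          ← mul_assoc, ← pow_succ]
      rw [this]
      exact S.add_mem (S.sub_mem (memA _) (memA _)) (ih _ (by omega))

lemma memD : g 1 1 ∈ S := by simpa using memAD 0

/-- A set of conditions which gives stability under left multiplication. -/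
lemma stable_of (x : UT) (hA : ∀ m, x * g 0 0 ^ m ∈ S) (hB : x * g 0 1 ∈ S) (hC : x * g 1 0 ∈ S)
    (hAB : x * (g 0 0 * g 0 1) ∈ S) (hCA : x * (g 1 0 * g 0 0) ∈ S)
    (hCB : x * (g 1 0 * g 0 1) ∈ S) (hD : ∀ m, x * (g 0 0 ^ m * g 1 1) ∈ S) :
    ∀ y ∈ S, x * y ∈ S := by
  intro y hy
  induction hy using Submodule.span_induction with
  | mem y hy =>
    obtain ⟨i, rfl⟩ := hy
    rcases i with m | j | n
    · simpa [basisT, g] using hA m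
    · fin_cases j
      · exact hB
      · exact hC
      · simpa [basisT, g] using hAB
      · simpa [basisT, g] using hCA
      · simpa [basisT, g] using hCB
    · simpa [basisT, g] using hD n
  | zero => simp
  | add y z _ _ hy hz => rw [mul_add]; exact S.add_mem hy hz
  | smul r y _ hy => rw [mul_smul_comm]; exact S.smul_mem r hy

lemma stableA : ∀ y ∈ S, g 0 0 * y ∈ S := by
  have H := rels_g
  apply stable_of
  · intro m; rw [← pow_succ']; exact memA _
  · exact memAB
  · rw [H.ac]; exact S.zero_mem
  · rw [H.aab]; exact memB
  · rw [← mul_assoc, H.ac, zero_mul]; exact S.zero_mem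
  · rw [← mul_assoc, H.ac, zero_mul]; exact S.zero_mem
  · intro m; rw [← mul_assoc, ← pow_succ']; exact memAD _

lemma stableB : ∀ y ∈ S, g 0 1 * y ∈ S := by
  have H := rels_g
  have h2 : g 0 0 * g 0 0 = g 0 0 ^ 2 := (sq _).symm
  apply stable_of
  · rintro (_ | m)
    · simpa using memB
    · rw [pow_succ', ← mul_assoc, H.ba, zero_mul]; exact S.zero_mem
  · rw [H.bb]; exact S.zero_mem
  · rw [H.bc, h2]
    exact S.sub_mem (memA _) (by simpa using memAD 1)
  · rw [← mul_assoc, H.ba, zero_mul]; exact S.zero_mem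
  · rw [← mul_assoc, H.bc, sub_mul, mul_assoc _ (g 1 1), H.da, ← mul_assoc, h2, ← pow_succ]
    exact S.sub_mem (memA _) (memAD 2)
  · rw [← mul_assoc, H.bc, sub_mul, mul_assoc _ (g 1 1), H.db, mul_assoc, H.aab, mul_zero, sub_zero]
    exact memB
  · rintro (_ | m)
    · rw [pow_zero, one_mul, H.bd]; exact memAB
    · rw [pow_succ', mul_assoc, ← mul_assoc, H.ba, zero_mul]; exact S.zero_mem

lemma c_pow (m : ℕ) : g 1 0 * g 0 0 ^ m = g 1 0 ∨ g 1 0 * g 0 0 ^ m = g 1 0 * g 0 0 := by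
  induction m with
  | zero => left; simp
  | succ m ih =>
    rw [pow_succ, ← mul_assoc]
    rcases ih with h | h
    · right; rw [h]
    · left; rw [h, mul_assoc, rels_g.caa]

lemma stableC : ∀ y ∈ S, g 1 0 * y ∈ S := by
  have H := rels_g
  apply stable_of
  · intro m
    rcases c_pow m with h | h <;> rw [h]
    · exact memC
    · exact memCA
  · exact memCB
  · rw [H.cc]; exact S.zero_mem
  · rw [H.cab]
    exact S.sub_mem (S.add_mem (S.sub_mem (memA _) (memAD _)) memD) (by simpa using memA 1)
  · rw [← mul_assoc, H.cc, zero_mul]; exact S.zero_mem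
  · rw [← mul_assoc, H.cc, zero_mul]; exact S.zero_mem
  · intro m
    rw [← mul_assoc]
    rcases c_pow m with h | h <;> rw [h]
    · rw [H.cd]; exact S.zero_mem
    · rw [mul_assoc, ← H.da, ← mul_assoc, H.cd, zero_mul]; exact S.zero_mem

lemma d_pow (m : ℕ) : g 1 1 * g 0 0 ^ m = g 0 0 ^ m * g 1 1 :=
  (show Commute (g 1 1) (g 0 0) from rels_g.da).pow_right m

lemma stableD : ∀ y ∈ S, g 1 1 * y ∈ S := by
  have H := rels_g
  apply stable_of
  · intro m; rw [d_pow]; exact memAD m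
  · rw [H.db]; exact S.zero_mem
  · rw [H.dc]; exact memCA
  · rw [← mul_assoc, H.da, mul_assoc, H.db, mul_zero]; exact S.zero_mem
  · rw [← mul_assoc, H.dc, mul_assoc, H.caa]; exact memC
  · rw [← mul_assoc, H.dc, mul_assoc]; exact stableC _ memAB
  · intro m
    rw [← mul_assoc, d_pow, mul_assoc, H.dd, mul_add, ← mul_assoc _ (g 0 0), ← pow_succ]
    refine S.add_mem ?_ (memAD _)
    rcases m with _ | m
    · simpa using memCB
    · rw [pow_succ, mul_assoc, ← mul_assoc (g 0 0), H.ac, zero_mul, mul_zero]; exact S.zero_mem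

lemma spanning : Submodule.span ℚ (Set.range basisT) = ⊤ := by
  have key : ∀ x : FreeA, ∀ y ∈ S, mkT x * y ∈ S := by
    intro x
    induction x using FreeAlgebra.induction with
    | grade0 r =>
      intro y hy
      rw [AlgHom.commutes, ← Algebra.smul_def]
      exact S.smul_mem r hy
    | grade1 i =>
      fin_cases i
      · exact stableA
      · exact stableB
      · exact stableC
      · exact stableD
    | mul x y hx hy =>
      intro z hz
      rw [map_mul, mul_assoc]
      exact hx _ (hy _ hz)
    | add x y hx hy =>
      intro z hz
      rw [map_add, add_mul]
      exact S.add_mem (hx _ hz) (hy _ hz)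
  rw [eq_top_iff]
  rintro u -
  obtain ⟨x, rfl⟩ := RingQuot.mkAlgHom_surjective ℚ relT u
  have := key x 1 (by simpa using memA 0)
  rwa [mul_one] at this

open Polynomial in
/-- The one-parameter family of one-dimensional representations `a, d ↦ X`, `b, c ↦ 0`. -/
noncomputable def preP : FreeA →ₐ[ℚ] ℚ[X] := FreeAlgebra.lift ℚ ![X, 0, 0, X]

open Polynomial in
lemma preP_gen (i j : Fin 2) : preP (gen i j) = if i = j then X else 0 := by
  rw [preP, gen, FreeAlgebra.lift_ι_apply]
  fin_cases i <;> fin_cases j <;> simp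

open Polynomial in
/-- `preP` on the quotient. -/
noncomputable def repP : UT →ₐ[ℚ] ℚ[X] :=
  RingQuot.liftAlgHom ℚ ⟨preP, by
    rintro _ _ ⟨⟨i, j, k, l, s, t, rfl⟩, rfl⟩
    rw [eta_translator]
    simp only [map_sub, map_mul, apply_ite preP, map_zero, preP_gen]
    have h : (if j = k ∧ l = s then if i = t then (X : ℚ[X]) else 0 else 0) =
        if l = s ∧ t = i then if k = j then X else 0 else 0 := by
      by_cases h1 : j = k <;> by_cases h2 : l = s <;> by_cases h3 : i = t <;>
        simp [h1, h2, h3, eq_comm]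
    rw [h]; ring⟩

/-- The two-dimensional representation `x ↦ σ x`. -/
noncomputable def preM (σ : ℚ) : FreeA →ₐ[ℚ] Matrix (Fin 2) (Fin 2) ℚ :=
  FreeAlgebra.lift ℚ ![!![σ, 0; 0, 0], !![0, σ; 0, 0], !![0, 0; σ, 0], !![0, 0; 0, σ]]

lemma preM_gen (σ : ℚ) (i j : Fin 2) : preM σ (gen i j) = Matrix.single i j σ := by
  rw [preM, gen, FreeAlgebra.lift_ι_apply]
  ext p q
  fin_cases i <;> fin_cases j <;> fin_cases p <;> fin_cases q <;> simp [Matrix.single]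

/-- The representation `x ↦ σ x`, where `σ ^ 2 = 1`, on the quotient. -/
noncomputable def repM (σ : ℚ) (hσ : σ * σ = 1) : UT →ₐ[ℚ] Matrix (Fin 2) (Fin 2) ℚ :=
  RingQuot.liftAlgHom ℚ ⟨preM σ, by
    rintro _ _ ⟨⟨i, j, k, l, s, t, rfl⟩, rfl⟩
    rw [eta_translator]
    simp only [map_sub, map_mul, apply_ite (preM σ), map_zero, preM_gen, single3, hσ, one_mul]
    exact sub_self _⟩

open Polynomial in
lemma repP_g (i j : Fin 2) : repP (g i j) = if i = j then X else 0 := by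
  rw [g, mkT, repP, RingQuot.liftAlgHom_mkAlgHom_apply, preP_gen]

lemma repM_g (σ : ℚ) (hσ : σ * σ = 1) (i j : Fin 2) :
    repM σ hσ (g i j) = Matrix.single i j σ := by
  rw [g, mkT, repM, RingQuot.liftAlgHom_mkAlgHom_apply, preM_gen]

lemma repM_pow (σ : ℚ) (hσ : σ * σ = 1) (m : ℕ) :
    repM σ hσ (g 0 0) ^ (m + 1) = Matrix.single 0 0 (σ ^ (m + 1)) := by
  induction m with
  | zero => simp [repM_g]
  | succ m ih => rw [pow_succ, ih, repM_g, Matrix.single_mul_single_same, ← pow_succ]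

/-- Matrix coefficients of the representation `x ↦ x`. -/
noncomputable def cA (p q : Fin 2) : UT →ₗ[ℚ] ℚ :=
  (Matrix.entryLinearMap ℚ ℚ p q) ∘ₗ (repM 1 (by norm_num)).toLinearMap

/-- Matrix coefficients of the representation `x ↦ -x`. -/
noncomputable def cB (p q : Fin 2) : UT →ₗ[ℚ] ℚ :=
  (Matrix.entryLinearMap ℚ ℚ p q) ∘ₗ (repM (-1) (by norm_num)).toLinearMap

/-- Polynomial coefficients of `repP`. -/
noncomputable def cP (m : ℕ) : UT →ₗ[ℚ] ℚ :=
  (Polynomial.lcoeff ℚ m) ∘ₗ repP.toLinearMap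

/-- Values of `repP`. -/
noncomputable def cE (r : ℚ) : UT →ₗ[ℚ] ℚ :=
  (Polynomial.aeval r).toLinearMap ∘ₗ repP.toLinearMap

lemma cA_apply (p q : Fin 2) (x : UT) : cA p q x = repM 1 (by norm_num) x p q := rfl
lemma cB_apply (p q : Fin 2) (x : UT) : cB p q x = repM (-1) (by norm_num) x p q := rfl
lemma cP_apply (m : ℕ) (x : UT) : cP m x = (repP x).coeff m := rfl
lemma cE_apply (r : ℚ) (x : UT) : cE r x = Polynomial.aeval r (repP x) := rfl

/-- The coefficient functionals of `d`, `ad`, `a²d`. -/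
noncomputable def fD : Fin 3 → UT →ₗ[ℚ] ℚ :=
  ![(1 / 2 : ℚ) • (cA 1 1 - cB 1 1),
    (1 / 2 : ℚ) • ((cE 1 - cA 0 0) + (cE (-1) - cB 0 0)),
    (1 / 2 : ℚ) • ((cE 1 - cA 0 0) - (cE (-1) - cB 0 0)) - (1 / 2 : ℚ) • (cA 1 1 - cB 1 1)]

/-- The coefficient functionals of `b`, `c`, `ab`, `ca`, `cb`. -/
noncomputable def fB : Fin 5 → UT →ₗ[ℚ] ℚ :=
  ![(1 / 2 : ℚ) • (cA 0 1 - cB 0 1), (1 / 2 : ℚ) • (cA 1 0 - cB 1 0),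
    (1 / 2 : ℚ) • (cA 0 1 + cB 0 1), (1 / 2 : ℚ) • (cA 1 0 + cB 1 0),
    (1 / 2 : ℚ) • (cA 1 1 + cB 1 1) - cP 0]

/-- The coefficient functionals of all basis elements. -/
noncomputable def fT : ℕ ⊕ Fin 5 ⊕ Fin 3 → UT →ₗ[ℚ] ℚ
  | Sum.inl n => cP n - (if n = 1 then (1 : ℚ) else 0) • fD 0
      - (if n = 2 then (1 : ℚ) else 0) • fD 1 - (if n = 3 then (1 : ℚ) else 0) • fD 2
  | Sum.inr (Sum.inl j) => fB j
  | Sum.inr (Sum.inr n) => fD n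

lemma fD_pow (n : Fin 3) (m : ℕ) : fD n (g 0 0 ^ m) = 0 := by
  rcases m with _ | m
  · fin_cases n <;> simp [fD, cA_apply, cB_apply, cE_apply]
  · fin_cases n <;>
      simp [fD, cA_apply, cB_apply, cE_apply, repM_pow, repP_g, Matrix.single]

lemma fB_pow (n : Fin 5) (m : ℕ) : fB n (g 0 0 ^ m) = 0 := by
  rcases m with _ | m
  · fin_cases n <;> simp [fB, cA_apply, cB_apply, cP_apply] <;> norm_num
  · fin_cases n <;>
      simp [fB, cA_apply, cB_apply, cP_apply, repM_pow, repP_g, Matrix.single]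

lemma fD_B (n : Fin 3) (j : Fin 5) : fD n (basisT (Sum.inr (Sum.inl j))) = 0 := by
  fin_cases n <;> fin_cases j <;>
    simp [fD, basisT, mkT_gen, cA_apply, cB_apply, cE_apply, repM_g, repP_g, Matrix.single,
      Matrix.mul_apply]

lemma fB_B (n j : Fin 5) : fB n (basisT (Sum.inr (Sum.inl j))) = if n = j then 1 else 0 := by
  fin_cases n <;> fin_cases j <;>
    simp [fB, basisT, mkT_gen, cA_apply, cB_apply, cP_apply, repM_g, repP_g, Matrix.single,
      Matrix.mul_apply] <;> norm_num

lemma cP_B (n : ℕ) (j : Fin 5) : cP n (basisT (Sum.inr (Sum.inl j))) = 0 := by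
  fin_cases j <;> simp [basisT, mkT_gen, cP_apply, repP_g]

lemma fD_D (n j : Fin 3) : fD n (basisT (Sum.inr (Sum.inr j))) = if n = j then 1 else 0 := by
  fin_cases n <;> fin_cases j <;>
    simp [fD, basisT, mkT_gen, cA_apply, cB_apply, cE_apply, repM_g, repP_g, Matrix.single,
      Matrix.mul_apply, sq] <;> norm_num

lemma fB_D (n : Fin 5) (j : Fin 3) : fB n (basisT (Sum.inr (Sum.inr j))) = 0 := by
  fin_cases n <;> fin_cases j <;>
    simp [fB, basisT, mkT_gen, cA_apply, cB_apply, cP_apply, repM_g, repP_g, Matrix.single,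
      Matrix.mul_apply, sq]

lemma cP_D (n : ℕ) (j : Fin 3) :
    cP n (basisT (Sum.inr (Sum.inr j))) = if n = (j : ℕ) + 1 then 1 else 0 := by
  simp [basisT, mkT_gen, cP_apply, repP_g, ← pow_succ, Polynomial.coeff_X_pow]

lemma basisT_inl (m : ℕ) : basisT (Sum.inl m) = g 0 0 ^ m := by simp [basisT, g]

lemma dual_eq (i j : ℕ ⊕ Fin 5 ⊕ Fin 3) : fT i (basisT j) = if i = j then 1 else 0 := by
  rcases i with n | n | n <;> rcases j with m | m | m
  · simp [-ite_smul, fT, basisT_inl, fD_pow, cP_apply, repP_g, Polynomial.coeff_X_pow]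
  · simp [-ite_smul, fT, fD_B, cP_B]
  · fin_cases m <;> simp [-ite_smul, fT, fD_D, cP_D]
  · simp [fT, basisT_inl, fB_pow]
  · simp [fT, fB_B]
  · simp [fT, fB_D]
  · simp [fT, basisT_inl, fD_pow]
  · simp [fT, fD_B]
  · simp [fT, fD_D]

lemma indep : LinearIndependent ℚ basisT :=
  LinearIndependent.of_pairwise_dual_eq_zero_one basisT fT
    (fun i j h => by simp [dual_eq, h]) (fun i => by simp [dual_eq])

lemma notFinite : ¬ Module.Finite ℚ UT := by
  intro h
  have := LinearIndependent.lt_aleph0_of_finiteDimensional indep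
  simp at this

/-- `U(A^T)` is infinite dimensional over ℚ, with basis given by the cosets of the
monomials `a^m` for `m ≥ 0` (with `a⁰ = 1`), together with `b, c, ab, ca, cb`,
and `a^n·d` for `0 ≤ n ≤ 2`. -/
theorem UT_infinite_dimensional_basis :
    ¬ Module.Finite ℚ UT ∧
    LinearIndependent ℚ basisT ∧
    Submodule.span ℚ (Set.range basisT) = ⊤ := by
  exact ⟨notFinite, indep, spanning⟩
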